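/- arXiv:math/0510098 — 4 statements merged into one kernel-verified Lean document; each statement's English description precedes it below -/
import Mathlib

section
/- Let L be a meet semidistributive lattice, let x, y, z ∈ L, and suppose y_k = y_{k+1} and z_k = z_{k+1} for some k ≥ 0. Then x ∧ y_{k+1} = x ∧ (y ∨ z); in particular (L,x,y,z) is not an SD_{k+1}(∧)-failure. -/
/-- The pair of sequences `(y_n, z_n)` with `y_0 = y`, `z_0 = z`,
`y_{n+1} = y ⊔ (x ⊓ z_n)`, `z_{n+1} = z ⊔ (x ⊓ y_n)`. -/
def yzSeq {α : Type*} [Lattice α] (x y z : α) : ℕ → α × α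
  | 0 => (y, z)
  | n + 1 => (y ⊔ (x ⊓ (yzSeq x y z n).2), z ⊔ (x ⊓ (yzSeq x y z n).1))

/-- The sequence `y_n`. -/
def ySeq {α : Type*} [Lattice α] (x y z : α) (n : ℕ) : α := (yzSeq x y z n).1

/-- The sequence `z_n`. -/
def zSeq {α : Type*} [Lattice α] (x y z : α) (n : ℕ) : α := (yzSeq x y z n).2

theorem yzSeq_le_sup {α : Type*} [Lattice α] (x y z : α) (n : ℕ) :
    (yzSeq x y z n).1 ≤ y ⊔ z ∧ (yzSeq x y z n).2 ≤ y ⊔ z := by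
  induction n with
  | zero => exact ⟨le_sup_left, le_sup_right⟩
  | succ n ih =>
    exact ⟨sup_le le_sup_left (inf_le_right.trans ih.2),
      sup_le le_sup_right (inf_le_right.trans ih.1)⟩

/-- In a meet semidistributive lattice, if `y_k = y_{k+1}` and
`z_k = z_{k+1}`, then `x ⊓ y_{k+1} = x ⊓ (y ⊔ z)`; in particular `(L,x,y,z)` is not
an `SD_{k+1}(∧)`-failure. -/
theorem stable_seq_no_failure {α : Type*} [Lattice α]
    (hsd : ∀ a b c : α, a ⊓ b = a ⊓ c → a ⊓ b = a ⊓ (b ⊔ c))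
    (x y z : α) (k : ℕ)
    (hy : ySeq x y z k = ySeq x y z (k + 1))
    (hz : zSeq x y z k = zSeq x y z (k + 1)) :
    x ⊓ ySeq x y z (k + 1) = x ⊓ (y ⊔ z) := by
  have hY : ySeq x y z k = y ⊔ (x ⊓ zSeq x y z k) := hy
  have hZ : zSeq x y z k = z ⊔ (x ⊓ ySeq x y z k) := hz
  rw [← hy]
  have hyY : y ≤ ySeq x y z k := hY ▸ le_sup_left
  have hzZ : z ≤ zSeq x y z k := hZ ▸ le_sup_left
  have hzy : x ⊓ zSeq x y z k ≤ ySeq x y z k := le_sup_right.trans_eq hY.symm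
  have hyz : x ⊓ ySeq x y z k ≤ zSeq x y z k := le_sup_right.trans_eq hZ.symm
  have h := hsd x _ _ (le_antisymm (le_inf inf_le_left hyz) (le_inf inf_le_left hzy))
  exact le_antisymm (inf_le_inf_left x (yzSeq_le_sup x y z k).1)
    ((inf_le_inf_left x (sup_le_sup hyY hzZ)).trans_eq h.symm)
end

section
/- A finite lattice L is meet semidistributive if and only if there exists n ≥ 0 such that L satisfies SD_n(∧), i.e. x ∧ y_n = x ∧ (y ∨ z) for all x, y, z ∈ L. -/
theorem monotone_yzSeq {α : Type*} [Lattice α] (x y z : α) : Monotone (yzSeq x y z) := by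
  refine monotone_nat_of_le_succ fun n => ?_
  induction n with
  | zero => exact ⟨le_sup_left, le_sup_left⟩
  | succ n ih =>
    exact ⟨sup_le_sup_left (inf_le_inf_left x ih.2) y,
      sup_le_sup_left (inf_le_inf_left x ih.1) z⟩

theorem yzSeq_eq_of_inf_eq {α : Type*} [Lattice α] {x y z : α} (h : x ⊓ y = x ⊓ z) (n : ℕ) :
    yzSeq x y z n = (y, z) := by
  induction n with
  | zero => rfl
  | succ n ih =>
    simp only [yzSeq, ih, Prod.mk.injEq]
    exact ⟨by rw [← h, sup_eq_left]; exact inf_le_right,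
      by rw [h, sup_eq_left]; exact inf_le_right⟩

theorem yzSeq_le {α : Type*} [Lattice α] (x y z : α) (n : ℕ) :
    yzSeq x y z n ≤ (y ⊔ z, y ⊔ z) := by
  induction n with
  | zero => exact ⟨le_sup_left, le_sup_right⟩
  | succ n ih =>
    exact ⟨sup_le le_sup_left (inf_le_right.trans ih.2),
      sup_le le_sup_right (inf_le_right.trans ih.1)⟩

theorem inf_ySeq_eq_inf_zSeq_of_fixed {α : Type*} [Lattice α] {x y z : α} {n : ℕ}
    (h : yzSeq x y z n = yzSeq x y z (n + 1)) :
    x ⊓ ySeq x y z n = x ⊓ zSeq x y z n := by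
  have hy : x ⊓ zSeq x y z n ≤ ySeq x y z n :=
    le_sup_right.trans (congrArg Prod.fst h).ge
  have hz : x ⊓ ySeq x y z n ≤ zSeq x y z n :=
    le_sup_right.trans (congrArg Prod.snd h).ge
  exact le_antisymm (le_inf inf_le_left hz) (le_inf inf_le_left hy)

theorem ySeq_sup_zSeq {α : Type*} [Lattice α] (x y z : α) (n : ℕ) :
    ySeq x y z n ⊔ zSeq x y z n = y ⊔ z :=
  le_antisymm (sup_le (yzSeq_le x y z n).1 (yzSeq_le x y z n).2)
    (sup_le_sup (monotone_yzSeq x y z n.zero_le).1 (monotone_yzSeq x y z n.zero_le).2)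

/-- In a finite lattice the sequences stabilize at an index independent of the triple. -/
theorem exists_yzSeq_fixed (α : Type*) [Lattice α] [Finite α] :
    ∃ n : ℕ, ∀ x y z : α, yzSeq x y z n = yzSeq x y z (n + 1) := by
  have stab (p : α × α × α) :
      ∃ n, ∀ m, n ≤ m → yzSeq p.1 p.2.1 p.2.2 n = yzSeq p.1 p.2.1 p.2.2 m :=
    WellFoundedGT.monotone_chain_condition ⟨_, monotone_yzSeq p.1 p.2.1 p.2.2⟩
  choose f hf using stab
  obtain ⟨n, hn⟩ := Finite.exists_le f
  refine ⟨n, fun x y z => ?_⟩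
  have hle := hn (x, y, z)
  exact (hf (x, y, z) n hle).symm.trans (hf (x, y, z) (n + 1) (hle.trans n.le_succ))

/-- A finite lattice is meet semidistributive iff it satisfies
`SD_n(∧)` for some `n ≥ 0`. -/
theorem meetSemidistrib_iff_SDn {α : Type*} [Lattice α] [Finite α] :
    (∀ a b c : α, a ⊓ b = a ⊓ c → a ⊓ b = a ⊓ (b ⊔ c)) ↔
      ∃ n : ℕ, ∀ x y z : α, x ⊓ ySeq x y z n = x ⊓ (y ⊔ z) := by
  constructor
  · intro hsd
    obtain ⟨n, hn⟩ := exists_yzSeq_fixed α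
    refine ⟨n, fun x y z => ?_⟩
    rw [hsd _ _ _ (inf_ySeq_eq_inf_zSeq_of_fixed (hn x y z)), ySeq_sup_zSeq]
  · rintro ⟨n, hn⟩ a b c h
    simpa only [ySeq, yzSeq_eq_of_inf_eq h] using hn a b c
end

section
/- Let L be a finite meet semidistributive lattice in which SD_n(∧) fails, i.e. there exist x, y, z ∈ L with x ∧ y_n < x ∧ (y ∨ z). Then L contains a simple D-path of length n: there exist pairwise distinct join-irreducible elements j_0, j_1, …, j_n of L, with unique lower covers (j_i)_*, such that for each i with 1 ≤ i ≤ n, every lattice congruence on L relating j_{i-1} and (j_{i-1})_* also relates j_i and (j_i)_*. -/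
/-- A lattice congruence: an equivalence relation compatible with meets and joins. -/
def IsLatCong {α : Type*} [Lattice α] (θ : α → α → Prop) : Prop :=
  Equivalence θ ∧
    ∀ a b c d : α, θ a b → θ c d → θ (a ⊓ c) (b ⊓ d) ∧ θ (a ⊔ c) (b ⊔ d)

/-- `js` is the largest element strictly below `j`; in particular `j` is join-irreducible with
unique lower cover `js`. -/
def IsLargestBelow {α : Type*} [Lattice α] (j js : α) : Prop :=
  js < j ∧ ∀ w, w < j → w ≤ js

namespace IsLargestBelow

variable {α : Type*} [Lattice α] {j js : α}

theorem covBy (h : IsLargestBelow j js) : js ⋖ j :=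
  ⟨h.1, fun w hw hwj => (h.2 w hwj).not_gt hw⟩

theorem eq_of_covBy (h : IsLargestBelow j js) {w : α} (hw : w ⋖ j) : w = js :=
  (h.2 w hw.lt).eq_of_not_lt fun hlt => hw.2 hlt h.1

end IsLargestBelow

/-- Every congruence collapsing `is < i` collapses `js < j`. -/
def CollapseImp {α : Type*} [Lattice α] (i is j js : α) : Prop :=
  ∀ θ : α → α → Prop, IsLatCong θ → θ i is → θ j js

theorem CollapseImp.of_join_cover {α : Type*} [Lattice α] {i is j js p : α}
    (hj : IsLargestBelow j js) (hjp : ¬ j ≤ p) (hji : j ≤ p ⊔ i) (his : is ≤ p) :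
    CollapseImp i is j js := by
  intro θ hθ hi
  have h₁ := (hθ.2 p p i is (hθ.1.refl p) hi).2
  have h₂ := (hθ.2 j j _ _ (hθ.1.refl j) h₁).1
  rw [inf_eq_left.2 hji, sup_eq_left.2 his] at h₂
  have h₃ := (hθ.2 _ _ js js h₂ (hθ.1.refl js)).2
  rwa [sup_eq_left.2 hj.1.le, sup_eq_right.2 (hj.2 _ (inf_lt_left.2 hjp))] at h₃

theorem exists_isLargestBelow_of_not_le {α : Type*} [Lattice α] [Finite α] {a p : α}
    (h : ¬ a ≤ p) : ∃ i is : α, i ≤ a ∧ ¬ i ≤ p ∧ is ≤ p ∧ IsLargestBelow i is := by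
  obtain ⟨i, hia, hi⟩ := (Set.toFinite {i : α | ¬ i ≤ p}).exists_le_minimal h
  refine ⟨i, i ⊓ p, hia, hi.prop, inf_le_right, inf_lt_left.2 hi.prop, fun w hw => ?_⟩
  refine le_inf hw.le ?_
  by_contra hwp
  exact hw.not_ge (hi.le_of_le hwp hw.le)

theorem yzSeq_swap {α : Type*} [Lattice α] (x y z : α) (n : ℕ) :
    yzSeq x z y n = (yzSeq x y z n).swap := by
  induction n with
  | zero => rfl
  | succ n ih => simp [yzSeq, ih]

theorem ySeq_succ {α : Type*} [Lattice α] (x y z : α) (n : ℕ) :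
    ySeq x y z (n + 1) = y ⊔ (x ⊓ ySeq x z y n) := by
  simp [ySeq, yzSeq, yzSeq_swap x y z]

theorem le_ySeq {α : Type*} [Lattice α] (x y z : α) (n : ℕ) : y ≤ ySeq x y z n := by
  cases n with
  | zero => exact le_rfl
  | succ n => exact (ySeq_succ x y z n).symm ▸ le_sup_left

/-- One descending step: a join-irreducible witnessing failure at level `n + 1` lies strictly above
one witnessing failure at level `n` with the roles of `y` and `z` exchanged. -/
theorem exists_lt_collapseImp {α : Type*} [Lattice α] [Finite α]
    (hsd : ∀ a b c : α, a ⊓ b = a ⊓ c → a ⊓ b = a ⊓ (b ⊔ c))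
    {n : ℕ} {x y z j js : α} (hj : IsLargestBelow j js) (hjx : j ≤ x) (hjyz : j ≤ y ⊔ z)
    (hfail : ¬ j ≤ ySeq x y z (n + 1) ⊔ js) :
    ∃ i is : α, IsLargestBelow i is ∧ i < j ∧ ¬ i ≤ ySeq x z y n ⊔ is ∧
      CollapseImp i is j js := by
  have inf_eq : ∀ u, js ≤ u → ¬ j ≤ u → j ⊓ u = js := fun u hu hju =>
    (hj.2 _ (inf_lt_left.2 hju)).antisymm (le_inf hj.1.le hu)
  have hjz : j ≤ z ⊔ js := by
    by_contra hjz
    have h₁ := inf_eq _ le_sup_right hfail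
    have h₂ := hsd _ _ _ (h₁.trans (inf_eq _ le_sup_right hjz).symm)
    have h₃ : j ≤ (ySeq x y z (n + 1) ⊔ js) ⊔ (z ⊔ js) :=
      hjyz.trans (sup_le_sup ((le_ySeq x y z _).trans le_sup_left) le_sup_left)
    rw [h₁, inf_eq_left.2 h₃] at h₂
    exact hj.1.ne h₂
  have hjs : ¬ j ≤ ySeq x z y n := fun h => hfail <| by
    rw [ySeq_succ]
    exact (le_inf hjx h).trans (le_sup_right.trans le_sup_left)
  obtain ⟨p, hsp, hp⟩ := (Set.toFinite {p : α | ¬ j ≤ p}).exists_le_maximal hjs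
  have hjsp : ¬ js ≤ p := fun h =>
    hp.prop (hjz.trans (sup_le ((le_ySeq x z y n).trans hsp) h))
  obtain ⟨i, is, hi, hip, hisp, hI⟩ := exists_isLargestBelow_of_not_le hjsp
  refine ⟨i, is, hI, hi.trans_lt hj.1, fun h => hip (h.trans (sup_le hsp hisp)),
    .of_join_cover hj hp.prop ?_ hisp⟩
  by_contra h
  exact hip (le_sup_right.trans (hp.le_of_ge h le_sup_left))

theorem exists_strictMono_path {α : Type*} [Lattice α] [Finite α]
    (hsd : ∀ a b c : α, a ⊓ b = a ⊓ c → a ⊓ b = a ⊓ (b ⊔ c))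
    (n : ℕ) {x y z j js : α} (hj : IsLargestBelow j js) (hjx : j ≤ x) (hjyz : j ≤ y ⊔ z)
    (hfail : ¬ j ≤ ySeq x y z n ⊔ js) :
    ∃ f g : Fin (n + 1) → α, f (Fin.last n) = j ∧ g (Fin.last n) = js ∧ StrictMono f ∧
      (∀ i, IsLargestBelow (f i) (g i)) ∧
      ∀ i : Fin n, CollapseImp (f i.castSucc) (g i.castSucc) (f i.succ) (g i.succ) := by
  induction n generalizing y z j js with
  | zero =>
    exact ⟨fun _ => j, fun _ => js, rfl, rfl, Fin.strictMono_iff_lt_succ.2 fun i => i.elim0,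
      fun _ => hj, fun i => i.elim0⟩
  | succ n ih =>
    obtain ⟨i, is, hi, hij, hifail, himp⟩ := exists_lt_collapseImp hsd hj hjx hjyz hfail
    obtain ⟨f, g, hf, hg, hmono, hlb, hpath⟩ :=
      ih hi (hij.le.trans hjx) ((hij.le.trans hjyz).trans_eq (sup_comm _ _)) hifail
    refine ⟨Fin.snoc f j, Fin.snoc g js, by simp, by simp, ?_, ?_, ?_⟩
    · refine Fin.strictMono_iff_lt_succ.2 fun k => ?_
      induction k using Fin.lastCases with
      | last => simpa [hf] using hij
      | cast k =>
        rw [Fin.succ_castSucc, Fin.snoc_castSucc, Fin.snoc_castSucc]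
        exact hmono k.castSucc_lt_succ
    · intro k
      induction k using Fin.lastCases with
      | last => simpa using hj
      | cast k => simpa using hlb k
    · intro k
      induction k using Fin.lastCases with
      | last => simpa [hf, hg] using himp
      | cast k =>
        rw [Fin.succ_castSucc]
        simpa only [Fin.snoc_castSucc] using hpath k

/-- A finite meet semidistributive lattice in which `SD_n(∧)` fails
contains a simple `D`-path of length `n`: pairwise distinct join-irreducibles
`j_0, …, j_n` (with unique lower covers `(j_i)_*`) such that for `1 ≤ i ≤ n`, every
congruence relating `j_{i-1}` and `(j_{i-1})_*` relates `j_i` and `(j_i)_*`. -/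
theorem SDn_failure_gives_D_path {α : Type*} [Lattice α] [Finite α]
    (hsd : ∀ a b c : α, a ⊓ b = a ⊓ c → a ⊓ b = a ⊓ (b ⊔ c))
    (n : ℕ) (x y z : α) (hfail : x ⊓ ySeq x y z n < x ⊓ (y ⊔ z)) :
    ∃ j jstar : Fin (n + 1) → α,
      Function.Injective j ∧
      (∀ i : Fin (n + 1), jstar i ⋖ j i ∧ ∀ w : α, w ⋖ j i → w = jstar i) ∧
      (∀ i : Fin n, ∀ θ : α → α → Prop, IsLatCong θ →
        θ (j i.castSucc) (jstar i.castSucc) → θ (j i.succ) (jstar i.succ)) := by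
  have hnle : ¬ x ⊓ (y ⊔ z) ≤ ySeq x y z n := fun h => hfail.not_ge (le_inf inf_le_left h)
  obtain ⟨j, js, hj, hjn, hjs, hJ⟩ := exists_isLargestBelow_of_not_le hnle
  obtain ⟨f, g, -, -, hmono, hlb, hpath⟩ :=
    exists_strictMono_path hsd n hJ (hj.trans inf_le_left) (hj.trans inf_le_right)
      (fun h => hjn (h.trans (sup_le le_rfl hjs)))
  exact ⟨f, g, hmono.injective, fun i => ⟨(hlb i).covBy, fun _ => (hlb i).eq_of_covBy⟩, hpath⟩
end

section
/- Let L be a finite meet semidistributive lattice and let k be the maximal length of a simple D-path in L, i.e. every sequence of pairwise distinct join-irreducible elements j_0, …, j_m of L such that, for each i ∈ {1,…,m}, every lattice congruence relating j_{i-1} and (j_{i-1})_* also relates j_i and (j_i)_*, satisfies m ≤ k. Then L satisfies SD_n(∧) for every n > k: x ∧ y_n = x ∧ (y ∨ z) for all x, y, z ∈ L. -/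
/-- If `r` is not below `u` but all lower covers of `r` are, then `r` is join-irreducible. -/
theorem existsUnique_covBy_of_not_le {α : Type*} [Lattice α] [Finite α] {r u : α}
    (h : ∀ s, s ⋖ r → s ≤ u) (hr : ¬ r ≤ u) : ∃! s, s ⋖ r := by
  have hmin : ¬ IsMin r := fun hm => hr (hm.isBot u)
  obtain ⟨t, ht⟩ := not_isMin_iff.mp hmin
  obtain ⟨s, -, hs⟩ := exists_le_covBy_of_lt ht
  refine ⟨s, hs, fun w hw => ?_⟩
  by_contra hne
  exact hr ((hw.wcovBy.sup_eq hs.wcovBy hne).symm.le.trans (sup_le (h w hw) (h s hs)))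

/-- Every lattice congruence collapsing `q` onto its lower covers does the same to `p`. -/
def CongDominates {α : Type*} [Lattice α] (q p : α) : Prop :=
  ∀ θ : α → α → Prop, IsLatCong θ → (∀ s, s ⋖ q → θ q s) → ∀ s, s ⋖ p → θ p s

theorem congDominates_of_le_sup {α : Type*} [Lattice α] [Finite α] {q r u : α}
    (hq : ∃! s, s ⋖ q) (hr : ∃! s, s ⋖ r) (hru : ∀ s, s ⋖ r → s ≤ u)
    (hle : q ≤ r ⊔ u) (hqu : ¬ q ≤ u) : CongDominates r q := by
  intro θ hθ hcol s hs
  obtain ⟨t, ht, -⟩ := hr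
  have h1 := (hθ.2 _ _ _ _ (hcol t ht) (hθ.1.refl u)).2
  rw [sup_eq_right.mpr (hru t ht)] at h1
  have h2 := (hθ.2 _ _ _ _ (hθ.1.refl q) h1).1
  rw [inf_eq_left.mpr hle] at h2
  have hlt : q ⊓ u < q := inf_lt_left.mpr hqu
  obtain ⟨w, hw, hwq⟩ := exists_le_covBy_of_lt hlt
  obtain rfl := hq.unique hwq hs
  have h3 := (hθ.2 _ _ _ _ h2 (hθ.1.refl w)).2
  rwa [sup_eq_left.mpr hs.le, sup_eq_right.mpr hw] at h3

/-- Join-irreducibles `q` whose collapse forces the collapse of `p`. -/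
def IsDominating {α : Type*} [Lattice α] (p q : α) : Prop :=
  (∃! s, s ⋖ q) ∧ CongDominates q p

theorem IsDominating.le_sup {α : Type*} [Lattice α] [Finite α] {p a b c d : α}
    (hab : ∀ q, IsDominating p q → q ≤ a → q ≤ b)
    (hcd : ∀ q, IsDominating p q → q ≤ c → q ≤ d)
    {q : α} (hq : IsDominating p q) (hle : q ≤ a ⊔ c) : q ≤ b ⊔ d := by
  let F : Set (Set α) :=
    {S | IsLowerSet S ∧ (∀ s ∈ S, s ≤ a ∨ s ≤ c) ∧ ∀ v ∈ upperBounds S, q ≤ v}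
  have hF : F.Nonempty := by
    refine ⟨{s | s ≤ a ∨ s ≤ c}, ?_, fun s hs => hs, fun v hv => ?_⟩
    · rintro s t hts (hs | hs)
      · exact Or.inl (hts.trans hs)
      · exact Or.inr (hts.trans hs)
    · exact hle.trans (sup_le (hv (Or.inl le_rfl)) (hv (Or.inr le_rfl)))
  obtain ⟨S, hS⟩ := (Set.toFinite F).exists_minimal hF
  obtain ⟨⟨hlow, hac, hub⟩, hmin⟩ := hS
  apply hub
  intro s hs
  obtain ⟨r, hsr, hr⟩ := (Set.toFinite S).exists_le_maximal hs
  have hcov : ∃ u ∈ upperBounds (S \ {r}), ¬ q ≤ u := by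
    by_contra! hcon
    have hmem : S \ {r} ∈ F := by
      refine ⟨?_, fun t ht => hac t ht.1, hcon⟩
      rintro t w hwt ⟨ht, htr⟩
      refine ⟨hlow hwt ht, ?_⟩
      rintro rfl
      exact htr (le_antisymm (hr.2 ht hwt) hwt)
    exact (hmin hmem Set.sdiff_subset hr.1).2 rfl
  obtain ⟨u, hu, hqu⟩ := hcov
  have hcovu : ∀ t, t ⋖ r → t ≤ u := fun t ht => hu ⟨hlow ht.le hr.1, ht.ne⟩
  have hru : ¬ r ≤ u := by
    intro hru
    refine hqu (hub u fun t ht => ?_)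
    by_cases htr : t = r
    · exact htr ▸ hru
    · exact hu ⟨ht, htr⟩
  have hrJ := existsUnique_covBy_of_not_le hcovu hru
  have hqr : q ≤ r ⊔ u := by
    refine hub _ fun t ht => ?_
    by_cases htr : t = r
    · exact htr ▸ le_sup_left
    · exact (hu ⟨ht, htr⟩).trans le_sup_right
  have hdom : IsDominating p r := ⟨hrJ, fun θ hθ h =>
    hq.2 θ hθ (congDominates_of_le_sup hq.1 hrJ hcovu hqr hqu θ hθ h)⟩
  refine hsr.trans ?_
  rcases hac r hr.1 with h | h
  · exact (hab r hdom h).trans le_sup_left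
  · exact (hcd r hdom h).trans le_sup_right

/-- There is a largest element whose dominating join-irreducibles all lie below `b`. -/
theorem IsDominating.exists_greatest {α : Type*} [Lattice α] [Finite α] (p b : α) :
    ∃ m, IsGreatest {a | ∀ q, IsDominating p q → q ≤ a → q ≤ b} m := by
  obtain ⟨m, hm⟩ :=
    (Set.toFinite {a | ∀ q, IsDominating p q → q ≤ a → q ≤ b}).exists_maximal
      ⟨b, fun _ _ h => h⟩
  refine ⟨m, hm.1, fun a ha => ?_⟩
  refine le_sup_right.trans (hm.2 (y := m ⊔ a) ?_ le_sup_left)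
  intro q hq hle
  simpa using hq.le_sup hm.1 ha hle

/-- In a meet semidistributive lattice, a join-irreducible below `b ⊔ c` but below neither `b` nor
`c` properly contains a join-irreducible dominating it that is not below both `b` and `c`. -/
theorem exists_lt_congDominates {α : Type*} [Lattice α] [Finite α]
    (hsd : ∀ a b c : α, a ⊓ b = a ⊓ c → a ⊓ b = a ⊓ (b ⊔ c)) {p b c : α}
    (hp : ∃! s, s ⋖ p) (hle : p ≤ b ⊔ c) (hb : ¬ p ≤ b) (hc : ¬ p ≤ c) :
    ∃ q, q < p ∧ (∃! s, s ⋖ q) ∧ CongDominates q p ∧ (¬ q ≤ b ∨ ¬ q ≤ c) := by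
  by_contra! hcon
  have hcon' : ∀ q, IsDominating p q → q < p → q ≤ b ∧ q ≤ c :=
    fun q hq hlt => hcon q hlt hq.1 hq.2
  obtain ⟨P, hP⟩ := IsDominating.exists_greatest p p
  obtain ⟨B, hB⟩ := IsDominating.exists_greatest p b
  obtain ⟨C, hC⟩ := IsDominating.exists_greatest p c
  have hbB : b ≤ B := hB.2 fun _ _ h => h
  have hcC : c ≤ C := hC.2 fun _ _ h => h
  have hpP : p ≤ P := hP.2 fun _ _ h => h
  have h1 : P ⊓ B = P ⊓ C := by
    apply le_antisymm
    · refine le_inf inf_le_left (hC.2 fun q hq hqle => ?_)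
      have hqb := hB.1 q hq (hqle.trans inf_le_right)
      have hqp := hP.1 q hq (hqle.trans inf_le_left)
      exact (hcon' q hq (hqp.lt_of_ne fun h => hb (h ▸ hqb))).2
    · refine le_inf inf_le_left (hB.2 fun q hq hqle => ?_)
      have hqc := hC.1 q hq (hqle.trans inf_le_right)
      have hqp := hP.1 q hq (hqle.trans inf_le_left)
      exact (hcon' q hq (hqp.lt_of_ne fun h => hc (h ▸ hqc))).1
  have hpB : p ≤ B := by
    have : p ≤ P ⊓ (B ⊔ C) := le_inf hpP (hle.trans (sup_le_sup hbB hcC))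
    rw [← hsd P B C h1] at this
    exact this.trans inf_le_right
  exact hb (hB.1 p ⟨hp, fun _ _ h => h⟩ hpB)

theorem yzSeq_le_succ {α : Type*} [Lattice α] (x y z : α) (n : ℕ) :
    ySeq x y z n ≤ ySeq x y z (n + 1) ∧ zSeq x y z n ≤ zSeq x y z (n + 1) := by
  induction n with
  | zero => exact ⟨le_sup_left, le_sup_left⟩
  | succ n ih =>
    exact ⟨sup_le_sup_left (inf_le_inf_left x ih.2) y, sup_le_sup_left (inf_le_inf_left x ih.1) z⟩

theorem yzSeq_bounds {α : Type*} [Lattice α] (x y z : α) (n : ℕ) :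
    (y ≤ ySeq x y z n ∧ ySeq x y z n ≤ y ⊔ z) ∧ (z ≤ zSeq x y z n ∧ zSeq x y z n ≤ y ⊔ z) := by
  induction n with
  | zero => exact ⟨⟨le_rfl, le_sup_left⟩, ⟨le_rfl, le_sup_right⟩⟩
  | succ n ih =>
    exact ⟨⟨le_sup_left, sup_le le_sup_left (inf_le_right.trans ih.2.2)⟩,
      ⟨le_sup_left, sup_le le_sup_right (inf_le_right.trans ih.1.2)⟩⟩

/-- A join-irreducible below `x ⊓ (y ⊔ z)` but not below both `y_n` and `z_n` is the top of an
increasing sequence of `n + 1` join-irreducibles, each dominating the next. -/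
theorem exists_dominating_path {α : Type*} [Lattice α] [Finite α]
    (hsd : ∀ a b c : α, a ⊓ b = a ⊓ c → a ⊓ b = a ⊓ (b ⊔ c)) (x y z : α) (n : ℕ) :
    ∀ p : α, (∃! s, s ⋖ p) → p ≤ x → p ≤ y ⊔ z →
      (¬ p ≤ ySeq x y z n ∨ ¬ p ≤ zSeq x y z n) →
      ∃ f : Fin (n + 1) → α, f (Fin.last n) = p ∧ (∀ i, ∃! s, s ⋖ f i) ∧
        ∀ i : Fin n, f i.castSucc < f i.succ ∧ CongDominates (f i.castSucc) (f i.succ) := by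
  induction n with
  | zero => exact fun p hp _ _ _ => ⟨fun _ => p, rfl, fun _ => hp, fun i => i.elim0⟩
  | succ n ih =>
    intro p hp hpx hpyz hn
    have hmono := yzSeq_le_succ x y z n
    have hyz : ¬ p ≤ ySeq x y z n ∧ ¬ p ≤ zSeq x y z n := by
      rcases hn with h | h
      · exact ⟨fun h' => h (h'.trans hmono.1), fun h' => h ((le_inf hpx h').trans le_sup_right)⟩
      · exact ⟨fun h' => h ((le_inf hpx h').trans le_sup_right), fun h' => h (h'.trans hmono.2)⟩
    have hbd := yzSeq_bounds x y z n
    obtain ⟨q, hqp, hq, hdom, hqn⟩ := exists_lt_congDominates hsd hp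
      (hpyz.trans (sup_le_sup hbd.1.1 hbd.2.1)) hyz.1 hyz.2
    obtain ⟨f, hfq, hfJ, hf⟩ := ih q hq (hqp.le.trans hpx) (hqp.le.trans hpyz) hqn
    refine ⟨Fin.snoc (α := fun _ => α) f p, Fin.snoc_last _ _, fun i => ?_, fun i => ?_⟩
    · induction i using Fin.lastCases with
      | last => simpa only [Fin.snoc_last] using hp
      | cast i => simpa only [Fin.snoc_castSucc] using hfJ i
    · induction i using Fin.lastCases with
      | last =>
        simp only [Fin.snoc_castSucc, Fin.succ_last, Fin.snoc_last, hfq]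
        exact ⟨hqp, hdom⟩
      | cast i =>
        simp only [Fin.snoc_castSucc, ← Fin.castSucc_succ]
        exact hf i

/-- If `k` bounds the length of every simple `D`-path in a finite
meet semidistributive lattice, then the lattice satisfies `SD_n(∧)` for every
`n > k`. -/
theorem D_path_bound_gives_SDn {α : Type*} [Lattice α] [Finite α]
    (hsd : ∀ a b c : α, a ⊓ b = a ⊓ c → a ⊓ b = a ⊓ (b ⊔ c))
    (k : ℕ)
    (hbound : ∀ (m : ℕ) (j jstar : Fin (m + 1) → α),
      Function.Injective j →
      (∀ i : Fin (m + 1), jstar i ⋖ j i ∧ ∀ w : α, w ⋖ j i → w = jstar i) →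
      (∀ i : Fin m, ∀ θ : α → α → Prop, IsLatCong θ →
        θ (j i.castSucc) (jstar i.castSucc) → θ (j i.succ) (jstar i.succ)) →
      m ≤ k) :
    ∀ n : ℕ, k < n → ∀ x y z : α, x ⊓ ySeq x y z n = x ⊓ (y ⊔ z) := by
  intro n hkn x y z
  have hbd := yzSeq_bounds x y z n
  refine le_antisymm (inf_le_inf_left x hbd.1.2) (le_inf inf_le_left ?_)
  by_contra hnot
  obtain ⟨p, hp⟩ := (Set.toFinite {w | w ≤ x ⊓ (y ⊔ z) ∧ ¬ w ≤ ySeq x y z n}).exists_minimal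
    ⟨_, le_rfl, hnot⟩
  have hpJ : ∃! s, s ⋖ p := by
    refine existsUnique_covBy_of_not_le (fun s hs => ?_) hp.1.2
    by_contra hsn
    exact hs.lt.not_ge (hp.2 ⟨hs.le.trans hp.1.1, hsn⟩ hs.le)
  obtain ⟨f, -, hfJ, hf⟩ := exists_dominating_path hsd x y z n p hpJ
    (hp.1.1.trans inf_le_left) (hp.1.1.trans inf_le_right) (Or.inl hp.1.2)
  choose g hg using hfJ
  refine absurd (hbound n f g ?_ hg ?_) (by omega)
  · exact (Fin.strictMono_iff_lt_succ.mpr fun i => (hf i).1).injective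
  · intro i θ hθ h
    refine (hf i).2 θ hθ (fun s hs => ?_) _ (hg i.succ).1
    rwa [(hg i.castSucc).2 s hs]
end
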